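/- Lower bound on the closest reachable point on the +x-axis when l − r ≡ 3 (mod 4): Let σ be a turn sequence with l L's and r R's, l − r ≥ 0 and l − r ≡ 3 (mod 4), and let C be any chain realizing σ whose endpoint is p = (a, 0) with a > 0. If σ₁ = L, then a ≥ min{₊ₓm₊ᵧᵒ(C), ₊ₓm₋ᵧᵖ(C)} + |⌊(l − r + 2)/4⌋ − 2| + 1. If σ₁ = R, then a ≥ ⌊(l − r + 2)/4⌋ + 1. -/

import Mathlib

/-- A turn: left (`L`) or right (`R`). -/
inductive Turn : Type
  | L : Turn
  | R : Turn
  deriving DecidableEq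

/-- Rotation of a direction vector by 90° counterclockwise. -/
def rotCCW (d : ℤ × ℤ) : ℤ × ℤ := (-d.2, d.1)

/-- Rotation of a direction vector by 90° clockwise. -/
def rotCW (d : ℤ × ℤ) : ℤ × ℤ := (d.2, -d.1)

/-- Unit direction of the axis-parallel segment from `u` to `v`. -/
def unitDir (u v : ℤ × ℤ) : ℤ × ℤ := ((v.1 - u.1).sign, (v.2 - u.2).sign)

/-- The set of integer points on the axis-parallel closed segment from `u` to `v`. -/
def segSet (u v : ℤ × ℤ) : Set (ℤ × ℤ) :=
  {q | min u.1 v.1 ≤ q.1 ∧ q.1 ≤ max u.1 v.1 ∧ min u.2 v.2 ≤ q.2 ∧ q.2 ≤ max u.2 v.2}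

/-- A simple rectilinear chain realizing the turn sequence `σ = σ₁⋯σₙ` (as a list,
`σ.get ⟨i, _⟩` is the `(i+1)`-st turn `σ_{i+1}`).  It consists of the points
`pts 0, …, pts (n+1)` with `pts 0 = (0,0)`; consecutive points span nondegenerate
axis-parallel segments, the first segment heads east, the chain turns left (CCW) or
right (CW) at each bend as prescribed by `σ`, and the chain is simple. -/
structure Chain (σ : List Turn) where
  pts : ℕ → ℤ × ℤ
  start_eq : pts 0 = (0, 0)
  first_seg : ∃ t : ℤ, 0 < t ∧ pts 1 = (t, 0)
  axis_parallel : ∀ i ≤ σ.length,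
    ((pts (i + 1)).1 = (pts i).1 ∧ (pts (i + 1)).2 ≠ (pts i).2) ∨
    ((pts (i + 1)).2 = (pts i).2 ∧ (pts (i + 1)).1 ≠ (pts i).1)
  turns : ∀ i, ∀ h : i < σ.length,
    unitDir (pts (i + 1)) (pts (i + 2)) =
      (if σ.get ⟨i, h⟩ = Turn.L then rotCCW else rotCW) (unitDir (pts i) (pts (i + 1)))
  simple_adj : ∀ i, i + 1 ≤ σ.length →
    segSet (pts i) (pts (i + 1)) ∩ segSet (pts (i + 1)) (pts (i + 2)) = {pts (i + 1)}
  simple_nonadj : ∀ i j, i + 1 < j → j ≤ σ.length →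
    segSet (pts i) (pts (i + 1)) ∩ segSet (pts j) (pts (j + 1)) = ∅

/-- `A(σ)`: the set of points reachable by the turn sequence `σ`. -/
def ReachSet (σ : List Turn) : Set (ℤ × ℤ) :=
  {q | ∃ C : Chain σ, C.pts (σ.length + 1) = q}

/-- The halfplane `V⁺(p)` (requires `p.1 ≠ 0` to be meaningful). -/
def Vplus (p : ℤ × ℤ) : Set (ℤ × ℤ) :=
  {q | ∃ i j : ℤ, 0 ≤ i ∧ q = (p.1 + p.1.sign * i, j)}

/-- The halfplane `H⁺(p)` (requires `p.2 ≠ 0` to be meaningful). -/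
def Hplus (p : ℤ × ℤ) : Set (ℤ × ℤ) :=
  {q | ∃ i j : ℤ, 0 ≤ j ∧ q = (i, p.2 + p.2.sign * j)}

/-- The quadrant `Q⁺(p)`. -/
def Qplus (p : ℤ × ℤ) : Set (ℤ × ℤ) := Vplus p ∩ Hplus p

/-- A staircase: consecutive turns always differ. -/
def IsStaircase (σ : List Turn) : Prop := σ.Chain' (· ≠ ·)

/-- The prefix number `δᵢ`: number of `L`s minus number of `R`s among the first `i` turns. -/
def delta (σ : List Turn) (i : ℕ) : ℤ :=
  ((σ.take i).count Turn.L : ℤ) - ((σ.take i).count Turn.R : ℤ)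

/-- The excess number `l - r` of a turn sequence. -/
def excess (σ : List Turn) : ℤ := (σ.count Turn.L : ℤ) - (σ.count Turn.R : ℤ)

/-- `σ` has a hook (two equal consecutive turns, at 1-based positions `k+1, k+2`)
whose prefix number is `≡ d (mod 4)`: `d = 0, 1, 2, 3` for right, up, left, down hooks. -/
def HasHook (σ : List Turn) (d : ℤ) : Prop :=
  ∃ k, ∃ h : k + 1 < σ.length,
    σ.get ⟨k, by omega⟩ = σ.get ⟨k + 1, h⟩ ∧ delta σ (k + 1) % 4 = d

/-- `σ` has some hook, i.e. two equal consecutive turns. -/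
def HasAnyHook (σ : List Turn) : Prop :=
  ∃ k, ∃ h : k + 1 < σ.length, σ.get ⟨k, by omega⟩ = σ.get ⟨k + 1, h⟩

/-- A set `S ⊆ ℤ²` is connected: any two points of `S` are joined by a path inside `S`
whose consecutive points are at `L¹`-distance `1`. -/
def GridConnected (S : Set (ℤ × ℤ)) : Prop :=
  ∀ p ∈ S, ∀ q ∈ S, ∃ (n : ℕ) (f : ℕ → ℤ × ℤ),
    f 0 = p ∧ f n = q ∧ (∀ i ≤ n, f i ∈ S) ∧
    ∀ i < n, |(f (i + 1)).1 - (f i).1| + |(f (i + 1)).2 - (f i).2| = 1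

/-- `q` lies on the boundary of the smallest axis-parallel bounding box of the chain `C`
(for `q` a point of the chain: it attains an extreme coordinate). -/
def OnBBoxBoundary (σ : List Turn) (C : Chain σ) (q : ℤ × ℤ) : Prop :=
  (∀ i ≤ σ.length + 1, q.1 ≤ (C.pts i).1) ∨ (∀ i ≤ σ.length + 1, (C.pts i).1 ≤ q.1) ∨
  (∀ i ≤ σ.length + 1, q.2 ≤ (C.pts i).2) ∨ (∀ i ≤ σ.length + 1, (C.pts i).2 ≤ q.2)

/-- The last segment of the chain `C` is entirely contained in one side of the smallest
axis-parallel bounding box of `C`. -/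
def LastSegOnSide (σ : List Turn) (C : Chain σ) : Prop :=
  ((C.pts σ.length).1 = (C.pts (σ.length + 1)).1 ∧
     ∀ i ≤ σ.length + 1, (C.pts σ.length).1 ≤ (C.pts i).1) ∨
  ((C.pts σ.length).1 = (C.pts (σ.length + 1)).1 ∧
     ∀ i ≤ σ.length + 1, (C.pts i).1 ≤ (C.pts σ.length).1) ∨
  ((C.pts σ.length).2 = (C.pts (σ.length + 1)).2 ∧
     ∀ i ≤ σ.length + 1, (C.pts σ.length).2 ≤ (C.pts i).2) ∨
  ((C.pts σ.length).2 = (C.pts (σ.length + 1)).2 ∧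
     ∀ i ≤ σ.length + 1, (C.pts i).2 ≤ (C.pts σ.length).2)

/-- The turn `σₘ` (1-based indexing). -/
def turnAt (σ : List Turn) (m : ℕ) : Turn := σ.getD (m - 1) Turn.L

/-- The suffix `σ_k ⋯ σ_n` contains no hook and all its prefix numbers `δᵢ`,
`k - 1 ≤ i ≤ n`, are `≡ 1` or `2 (mod 4)` (the combinatorial description of a
NW-staircase containing the endpoint). -/
def GoodSuffix (σ : List Turn) (k : ℕ) : Prop :=
  1 ≤ k ∧ k ≤ σ.length ∧
  (∀ m : ℕ, k ≤ m → m < σ.length → turnAt σ m ≠ turnAt σ (m + 1)) ∧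
  (∀ i : ℕ, k - 1 ≤ i → i ≤ σ.length → delta σ i % 4 = 1 ∨ delta σ i % 4 = 2)

open Classical in
/-- `₋ₓm₊ᵧᵖ(σ)`: taking the longest good suffix (i.e. the least `k` with
`GoodSuffix σ k`), the number of indices `i` with `k - 1 ≤ i ≤ n` and
`δᵢ ≡ 1 (mod 4)`; `0` if no good suffix exists. -/
noncomputable def mNWp (σ : List Turn) : ℕ :=
  if ∃ k, GoodSuffix σ k then
    Nat.card {i : ℕ // sInf {k | GoodSuffix σ k} - 1 ≤ i ∧ i ≤ σ.length ∧
      delta σ i % 4 = 1}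
  else 0

/-- The number of vertical segments of the chain `C` meeting the closed horizontal
segment from the origin to `(a, 0)`. -/
def verticalCrossCount (σ : List Turn) (C : Chain σ) (a : ℤ) : ℕ :=
  ((Finset.range (σ.length + 1)).filter fun i =>
    (C.pts i).1 = (C.pts (i + 1)).1 ∧
    0 ≤ (C.pts i).1 ∧ (C.pts i).1 ≤ a ∧
    min (C.pts i).2 (C.pts (i + 1)).2 ≤ 0 ∧ 0 ≤ max (C.pts i).2 (C.pts (i + 1)).2).card

/-- The unit direction of the `(i+1)`-st segment of the chain `C`. -/
def dirOf (σ : List Turn) (C : Chain σ) (i : ℕ) : ℤ × ℤ := unitDir (C.pts i) (C.pts (i + 1))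

/-- `z₁mz₂ᵒ(C)`: the number of `z₂`-segments in the maximal `(z₁,z₂)`-staircase subchain
of `C` containing the origin (the longest prefix of segments directed `z₁` or `z₂`);
`0` if no such subchain exists. -/
noncomputable def stairCountO (σ : List Turn) (C : Chain σ) (z₁ z₂ : ℤ × ℤ) : ℕ :=
  Nat.card {i : ℕ // i ≤ σ.length ∧ dirOf σ C i = z₂ ∧
    ∀ j ≤ i, dirOf σ C j = z₁ ∨ dirOf σ C j = z₂}

/-- `z₁mz₂ᵖ(C)`: the number of `z₂`-segments in the maximal `(z₁,z₂)`-staircase subchain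
of `C` containing the endpoint (the longest suffix of segments directed `z₁` or `z₂`);
`0` if no such subchain exists. -/
noncomputable def stairCountP (σ : List Turn) (C : Chain σ) (z₁ z₂ : ℤ × ℤ) : ℕ :=
  Nat.card {i : ℕ // i ≤ σ.length ∧ dirOf σ C i = z₂ ∧
    ∀ j, i ≤ j → j ≤ σ.length → dirOf σ C j = z₁ ∨ dirOf σ C j = z₂}

/-- The vector from `(x₀, y₀)` to `(x₁, y₁)` is nonzero, axis-parallel, and points in direction
`d` modulo four, where `0, 1, 2, 3` stand for east, north, west, south. -/
def AxisStep (x₀ y₀ x₁ y₁ d : ℤ) : Prop :=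
  (d % 4 = 0 ∧ x₀ < x₁ ∧ y₁ = y₀) ∨ (d % 4 = 1 ∧ x₁ = x₀ ∧ y₀ < y₁) ∨
  (d % 4 = 2 ∧ x₁ < x₀ ∧ y₁ = y₀) ∨ (d % 4 = 3 ∧ x₁ = x₀ ∧ y₁ < y₀)

/-- The bounding boxes of two segments are disjoint: the first with end points `(x₀, y₀)` and
`(x₁, y₁)`, the second with end points `(u₀, v₀)` and `(u₁, v₁)`. -/
def BoxSep (x₀ y₀ x₁ y₁ u₀ v₀ u₁ v₁ : ℤ) : Prop :=
  max x₀ x₁ < min u₀ u₁ ∨ max u₀ u₁ < min x₀ x₁ ∨ max y₀ y₁ < min v₀ v₁ ∨ max v₀ v₁ < min y₀ y₁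

/-- A simple rectilinear path with vertices `(x k, y k)`; the edge from the `k`-th to the next
vertex is in play for `lo ≤ k ≤ hi`, and `δ k` is its direction lifted to the integers. -/
structure SimplePath (x y δ : ℕ → ℤ) (lo hi : ℕ) : Prop where
  step : ∀ k, lo ≤ k → k ≤ hi → AxisStep (x k) (y k) (x (k + 1)) (y (k + 1)) (δ k)
  turn : ∀ k, lo ≤ k → k < hi → δ (k + 1) = δ k + 1 ∨ δ (k + 1) = δ k - 1
  sep : ∀ k l, lo ≤ k → k + 1 < l → l ≤ hi →
    BoxSep (x k) (y k) (x (k + 1)) (y (k + 1)) (x l) (y l) (x (l + 1)) (y (l + 1))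

/-- A simple closed rectilinear polygon with `N` edges and total turning `T`. -/
structure SimplePolygon (x y δ : ℕ → ℤ) (N : ℕ) (T : ℤ) : Prop where
  four_le : 4 ≤ N
  x_closed : x N = x 0
  y_closed : y N = y 0
  δ_closed : δ N = δ 0 + T
  dvd_turning : 4 ∣ T
  step : ∀ k < N, AxisStep (x k) (y k) (x (k + 1)) (y (k + 1)) (δ k)
  turn : ∀ k < N, δ (k + 1) = δ k + 1 ∨ δ (k + 1) = δ k - 1
  sep : ∀ k l, k + 1 < l → l < N → l + 1 < k + N →
    BoxSep (x k) (y k) (x (k + 1)) (y (k + 1)) (x l) (y l) (x (l + 1)) (y (l + 1))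

/-- Signed number of crossings of the open ray from the origin to the east, counted when moving
from `(u₀, v₀)` to `(u₁, v₁)` inside a half-plane avoiding the origin. -/
def rayCross (u₀ v₀ u₁ v₁ : ℤ) : ℤ :=
  if 0 < u₀ ∧ 0 < u₁ then (if 0 ≤ v₁ then 1 else 0) - (if 0 ≤ v₀ then 1 else 0) else 0

/-- Ray crossings of the secant from vertex `k` when its head moves from vertex `l` to the next. -/
def headCross (x y : ℕ → ℤ) (k l : ℕ) : ℤ :=
  rayCross (x l - x k) (y l - y k) (x (l + 1) - x k) (y (l + 1) - y k)

/-- Ray crossings of the secant to vertex `l` when its tail moves from vertex `k` to the next. -/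
def tailCross (x y : ℕ → ℤ) (k l : ℕ) : ℤ :=
  rayCross (x l - x k) (y l - y k) (x l - x (k + 1)) (y l - y (k + 1))

theorem BoxSep.symm {x₀ y₀ x₁ y₁ u₀ v₀ u₁ v₁ : ℤ} (h : BoxSep x₀ y₀ x₁ y₁ u₀ v₀ u₁ v₁) :
    BoxSep u₀ v₀ u₁ v₁ x₀ y₀ x₁ y₁ := by
  unfold BoxSep at *
  omega

/-- Moving head and tail of the secant along two disjoint edges does not depend on the order. -/
theorem headCross_add_tailCross (x y : ℕ → ℤ) (k l : ℕ)
    (h : BoxSep (x k) (y k) (x (k + 1)) (y (k + 1)) (x l) (y l) (x (l + 1)) (y (l + 1))) :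
    headCross x y k l + tailCross x y k (l + 1) = tailCross x y k l + headCross x y (k + 1) l := by
  unfold headCross tailCross rayCross
  rcases h with h | h | h | h <;> simp only [max_lt_iff, lt_min_iff] at h <;> grind

/-- At a vertex, the secant crosses the eastern ray as often as the lifted direction does. -/
theorem headCross_add_tailCross_of_turn (x y δ : ℕ → ℤ) (k : ℕ)
    (h₀ : AxisStep (x k) (y k) (x (k + 1)) (y (k + 1)) (δ k))
    (h₁ : AxisStep (x (k + 1)) (y (k + 1)) (x (k + 2)) (y (k + 2)) (δ (k + 1)))
    (h : δ (k + 1) = δ k + 1 ∨ δ (k + 1) = δ k - 1) :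
    headCross x y k (k + 1) + tailCross x y k (k + 2) = δ (k + 1) / 4 - δ k / 4 := by
  unfold headCross tailCross rayCross
  rw [show k + 1 + 1 = k + 2 from rfl]
  unfold AxisStep at h₀ h₁
  rcases h₀ with h₀ | h₀ | h₀ | h₀ <;> rcases h₁ with h₁ | h₁ | h₁ | h₁ <;>
    split_ifs <;> omega

theorem headCross_add_sum_tailCross (x y : ℕ → ℤ) (n m : ℕ)
    (h : ∀ k < m, BoxSep (x (k + 1)) (y (k + 1)) (x (k + 2)) (y (k + 2))
      (x (n + 2)) (y (n + 2)) (x (n + 3)) (y (n + 3))) :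
    headCross x y 1 (n + 2) + ∑ k ∈ Finset.range m, tailCross x y (k + 1) (n + 3) =
      ∑ k ∈ Finset.range m, tailCross x y (k + 1) (n + 2) + headCross x y (m + 1) (n + 2) := by
  induction m with
  | zero => simp
  | succ m ih =>
    have := headCross_add_tailCross x y (m + 1) (n + 2) (h m (by omega))
    rw [Finset.sum_range_succ, Finset.sum_range_succ]
    have := ih fun k hk => h k (by omega)
    simp only [show n + 2 + 1 = n + 3 from rfl] at *
    linarith

/-- Hopf's secant argument: the winding of the tangent from edge `1` on is the winding of the
secants issuing from vertex `1` plus that of the secants pointing to the last vertex. -/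
theorem SimplePolygon.turning_eq_secants {x y δ : ℕ → ℤ} {N : ℕ} {T : ℤ}
    (P : SimplePolygon x y δ N T) (n : ℕ) (hn : n + 2 ≤ N) :
    δ (n + 1) / 4 - δ 1 / 4 = ∑ j ∈ Finset.range n, headCross x y 1 (j + 2) +
      ∑ k ∈ Finset.range n, tailCross x y (k + 1) (n + 2) := by
  induction n with
  | zero => simp
  | succ n ih =>
    have h₁ := headCross_add_sum_tailCross x y n n fun k hk =>
      P.sep (k + 1) (n + 2) (by omega) (by omega) (by omega)
    have h₂ := headCross_add_tailCross_of_turn x y δ (n + 1) (P.step _ (by omega))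
      (P.step _ (by omega)) (P.turn _ (by omega))
    rw [Finset.sum_range_succ, Finset.sum_range_succ]
    have := ih (by omega)
    simp only [show n + 1 + 1 = n + 2 from rfl, show n + 1 + 2 = n + 3 from rfl] at *
    linarith

/-- Evaluation of the secant winding at the leftmost lowest vertex `(xo, yo)` of a polygon, with
neighbours `(xe, ye)` and `(x₁, y₁)`; the vertex after `(x₁, y₁)` is `(x₂, y₂)`. -/
theorem turning_at_lowest_corner {xo yo xe ye x₁ y₁ x₂ y₂ d₀ d₁ d₂ d₃ T : ℤ}
    (key : d₂ / 4 - d₁ / 4 = rayCross (xe - xo) (ye - yo) (xe - x₁) (ye - y₁) -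
      rayCross (x₂ - xo) (y₂ - yo) (x₂ - x₁) (y₂ - y₁) +
      rayCross (xe - x₁) (ye - y₁) (xo - x₁) (yo - y₁))
    (s₀ : AxisStep xo yo x₁ y₁ d₀) (s₁ : AxisStep x₁ y₁ x₂ y₂ d₁) (s₂ : AxisStep xe ye xo yo d₂)
    (t₀ : d₁ = d₀ + 1 ∨ d₁ = d₀ - 1) (t₁ : d₃ = d₂ + 1 ∨ d₃ = d₂ - 1) (hd : d₃ = d₀ + T) (hT : 4 ∣ T)
    (l₁ : yo < y₁ ∨ (yo = y₁ ∧ xo ≤ x₁)) (l₂ : yo < y₂ ∨ (yo = y₂ ∧ xo ≤ x₂))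
    (l₃ : yo < ye ∨ (yo = ye ∧ xo ≤ xe)) : T = 4 ∨ T = -4 := by
  have hd' : d₀ % 4 = (d₂ + 1) % 4 ∨ d₀ % 4 = (d₂ - 1) % 4 := by omega
  have s₀' : (d₀ % 4 = 0 ∧ xo < x₁ ∧ y₁ = yo) ∨ (d₀ % 4 = 1 ∧ x₁ = xo ∧ yo < y₁) := by
    clear * - s₀ l₁
    unfold AxisStep at s₀
    omega
  have s₂' : (d₂ % 4 = 2 ∧ xo < xe ∧ yo = ye) ∨ (d₂ % 4 = 3 ∧ xo = xe ∧ yo < ye) := by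
    clear * - s₂ l₃
    unfold AxisStep at s₂
    omega
  clear s₀ s₂ l₁ l₃
  unfold rayCross at key
  rcases s₀' with ⟨e₀, s₀, rfl⟩ | ⟨e₀, rfl, s₀⟩ <;> rcases s₂' with ⟨e₂, s₂, rfl⟩ | ⟨e₂, rfl, s₂⟩
  · clear * - hd' e₀ e₂
    omega
  · have s₁' : d₁ % 4 = 1 ∧ y₁ < y₂ := by
      clear * - s₁ t₀ l₂ e₀
      unfold AxisStep at s₁
      omega
    rw [if_neg (by omega), if_pos (by omega : 0 ≤ y₂ - y₁),
      if_neg (by omega : ¬ (0 < xo - x₁ ∧ 0 < xo - x₁)), sub_self, ite_self] at key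
    clear * - key s₁' t₀ t₁ hd hT e₀ e₂
    omega
  · have s₁' : y₂ = y₁ := by
      clear * - s₁ t₀ e₀
      unfold AxisStep at s₁
      omega
    rw [if_pos (by omega), if_neg (by omega : ¬ 0 ≤ yo - y₁), if_pos (by omega : 0 ≤ yo - yo),
      if_pos (by omega : 0 ≤ y₂ - y₁), if_pos (by omega : 0 ≤ y₂ - yo), sub_self, ite_self,
      if_neg (by omega)] at key
    clear * - key t₀ t₁ hd hT e₀ e₂
    omega
  · clear * - hd' e₀ e₂
    omega

/-- A simple polygon starting at its leftmost lowest vertex has total turning `±4`. -/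
theorem SimplePolygon.turning_of_lowest {x y δ : ℕ → ℤ} {N : ℕ} {T : ℤ}
    (P : SimplePolygon x y δ N T)
    (hlow : ∀ k < N, y 0 < y k ∨ (y 0 = y k ∧ x 0 ≤ x k)) : T = 4 ∨ T = -4 := by
  obtain ⟨M, rfl⟩ : ∃ M, N = M + 3 := ⟨N - 3, by have := P.four_le; omega⟩
  have hx := P.x_closed
  have hy := P.y_closed
  have hlow' : ∀ k ≤ M + 3, y 0 < y k ∨ (y 0 = y k ∧ x 0 ≤ x k) := by
    intro k hk
    rcases hk.lt_or_eq with hk | rfl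
    · exact hlow k hk
    · omega
  have htail : ∑ k ∈ Finset.range (M + 1), tailCross x y (k + 1) (M + 3) = 0 := by
    refine Finset.sum_eq_zero fun k hk => ?_
    rw [Finset.mem_range] at hk
    have h₁ := hlow' (k + 1) (by omega)
    have h₂ := hlow' (k + 2) (by omega)
    unfold tailCross rayCross
    rw [hx, hy, show k + 1 + 1 = k + 2 from rfl]
    split_ifs <;> omega
  have hhead : ∀ m ≤ M, ∑ j ∈ Finset.range m, headCross x y 1 (j + 2) =
      tailCross x y 0 (m + 2) - tailCross x y 0 2 := by
    intro m
    induction m with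
    | zero => simp
    | succ m ih =>
      intro hm
      have h₀ : headCross x y 0 (m + 2) = 0 := by
        have h₁ := hlow' (m + 2) (by omega)
        have h₂ := hlow' (m + 3) (by omega)
        unfold headCross rayCross
        rw [show m + 2 + 1 = m + 3 from rfl]
        split_ifs <;> omega
      have h₁ := headCross_add_tailCross x y 0 (m + 2) (P.sep _ _ (by omega) (by omega) (by omega))
      rw [Finset.sum_range_succ, ih (by omega)]
      rw [show m + 2 + 1 = m + 3 from rfl] at h₁
      rw [show m + 1 + 2 = m + 3 from rfl]
      rw [zero_add] at h₁
      linarith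
  have hM : 1 ≤ M := by have := P.four_le; omega
  have key := P.turning_eq_secants (M + 1) (by omega)
  rw [show M + 1 + 2 = M + 3 from rfl, htail, Finset.sum_range_succ, hhead M le_rfl, add_zero]
    at key
  unfold headCross tailCross at key
  have s₂ := P.step (M + 2) (by omega)
  rw [show M + 2 + 1 = M + 3 from rfl, hx, hy] at key s₂
  exact turning_at_lowest_corner key (P.step 0 (by omega)) (P.step 1 (by omega)) s₂
    (P.turn 0 (by omega)) (P.turn (M + 2) (by omega)) P.δ_closed P.dvd_turning
    (hlow' 1 (by omega)) (hlow' 2 (by omega)) (hlow' (M + 2) (by omega))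

/-- Start the polygon at vertex `s` instead of vertex `0`. -/
theorem SimplePolygon.rotate {x y δ : ℕ → ℤ} {N : ℕ} {T : ℤ} (P : SimplePolygon x y δ N T)
    (s : ℕ) (hs : s < N) :
    SimplePolygon (fun k => if s + k < N then x (s + k) else x (s + k - N))
      (fun k => if s + k < N then y (s + k) else y (s + k - N))
      (fun k => if s + k < N then δ (s + k) else δ (s + k - N) + T) N T := by
  have hx := P.x_closed
  have hy := P.y_closed
  have hδ := P.δ_closed
  have ex : ∀ k, s + k < N → (if s + (k + 1) < N then x (s + (k + 1)) else x (s + (k + 1) - N)) =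
      x (s + k + 1) := by
    intro k hk
    split_ifs with h
    · rfl
    · rw [show s + (k + 1) - N = 0 by omega, show s + k + 1 = N by omega, hx]
  have ey : ∀ k, s + k < N → (if s + (k + 1) < N then y (s + (k + 1)) else y (s + (k + 1) - N)) =
      y (s + k + 1) := by
    intro k hk
    split_ifs with h
    · rfl
    · rw [show s + (k + 1) - N = 0 by omega, show s + k + 1 = N by omega, hy]
  have eδ : ∀ k, s + k < N →
      (if s + (k + 1) < N then δ (s + (k + 1)) else δ (s + (k + 1) - N) + T) =
      δ (s + k + 1) := by
    intro k hk
    split_ifs with h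
    · rfl
    · rw [show s + (k + 1) - N = 0 by omega, show s + k + 1 = N by omega, hδ]
  have e : ∀ k, N ≤ s + k → s + (k + 1) - N = s + k - N + 1 := by omega
  refine ⟨P.four_le, ?_, ?_, ?_, P.dvd_turning, ?_, ?_, ?_⟩
  · simp [hs]
  · simp [hs]
  · simp [hs]
  · intro k hk
    by_cases h : s + k < N
    · simp only [ex k h, ey k h, if_pos h]
      exact P.step _ h
    · simp only [if_neg h, if_neg (by omega : ¬ s + (k + 1) < N), e k (by omega)]
      have := P.step (s + k - N) (by omega)
      have := P.dvd_turning
      unfold AxisStep at *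
      omega
  · intro k hk
    by_cases h : s + k < N
    · simp only [eδ k h, if_pos h]
      exact P.turn _ h
    · simp only [if_neg h, if_neg (by omega : ¬ s + (k + 1) < N), e k (by omega)]
      have := P.turn (s + k - N) (by omega)
      omega
  · intro k l h₁ h₂ h₃
    by_cases hl : s + l < N
    · have hk : s + k < N := by omega
      simp only [ex k hk, ey k hk, if_pos hk, ex l hl, ey l hl, if_pos hl]
      exact P.sep _ _ (by omega) hl (by omega)
    · simp only [if_neg hl, if_neg (by omega : ¬ s + (l + 1) < N), e l (by omega)]
      by_cases hk : s + k < N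
      · simp only [ex k hk, ey k hk, if_pos hk]
        exact (P.sep _ _ (by omega) hk (by omega)).symm
      · simp only [if_neg hk, if_neg (by omega : ¬ s + (k + 1) < N), e k (by omega)]
        exact P.sep _ _ (by omega) (by omega) (by omega)

/-- A simple rectilinear polygon has total turning `±4`. -/
theorem SimplePolygon.turning {x y δ : ℕ → ℤ} {N : ℕ} {T : ℤ}
    (P : SimplePolygon x y δ N T) : T = 4 ∨ T = -4 := by
  have hN := P.four_le
  obtain ⟨s, hs, hmin⟩ := Finset.exists_min_image (Finset.range N)
    (fun k => toLex (y k, x k)) ⟨0, by simp; omega⟩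
  rw [Finset.mem_range] at hs
  refine (P.rotate s hs).turning_of_lowest fun k hk => ?_
  have key : ∀ m < N, y s < y m ∨ (y s = y m ∧ x s ≤ x m) := fun m hm => by
    have := hmin m (Finset.mem_range.2 hm)
    rwa [Prod.Lex.toLex_le_toLex] at this
  simp only [add_zero, if_pos hs]
  split_ifs with h
  · exact key _ h
  · exact key _ (by omega)

/-- Edge `k` is vertical and crosses the horizontal line at height `c`. -/
def CrossesLevel (y δ : ℕ → ℤ) (c : ℤ) (k : ℕ) : Prop :=
  (δ k % 4 = 1 ∧ y k < c ∧ c < y (k + 1)) ∨ (δ k % 4 = 3 ∧ y (k + 1) < c ∧ c < y k)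

/-- If two edges of a simple path cross a horizontal line and no edge between them crosses the
line between these two crossings, then closing the path along the line gives a simple polygon. -/
theorem SimplePath.turning_of_free_level {x y δ : ℕ → ℤ} {lo top : ℕ}
    (P : SimplePath x y δ lo top) {c : ℤ} {i j : ℕ} (hc : ∀ k, lo ≤ k → k ≤ top + 1 → y k ≠ c)
    (hi : lo ≤ i) (hij : i < j) (hj : j ≤ top)
    (ci : CrossesLevel y δ c i) (cj : CrossesLevel y δ c j) (hx : x i < x j)
    (hfree : ∀ k, i < k → k < j → CrossesLevel y δ c k → x i < x k → x k < x j → False) :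
    (δ i % 4 = 1 → δ j % 4 = 1 → δ j - δ i = 4 ∨ δ j - δ i = -4) ∧
    (δ i % 4 = 1 → δ j % 4 = 3 → δ j - δ i = 6 ∨ δ j - δ i = -2) ∧
    (δ i % 4 = 3 → δ j % 4 = 1 → δ j - δ i = 2 ∨ δ j - δ i = -6) ∧
    (δ i % 4 = 3 → δ j % 4 = 3 → δ j - δ i = 4 ∨ δ j - δ i = -4) := by
  have si := P.step i hi (by omega)
  have sj := P.step j (by omega) hj
  have hij' : i + 1 < j := by
    by_contra h
    obtain rfl : j = i + 1 := by omega
    have := P.turn i hi (by omega)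
    unfold CrossesLevel at ci cj
    omega
  obtain ⟨n, rfl⟩ : ∃ n, j = i + n := ⟨j - i, by omega⟩
  obtain ⟨dc, hdc⟩ : ∃ d : ℤ, d = if δ (i + n) % 4 = 1 then δ (i + n) + 1 else δ (i + n) - 1 :=
    ⟨_, rfl⟩
  obtain ⟨T, hT⟩ : ∃ T : ℤ, T = (if δ i % 4 = 1 then dc - 1 else dc + 1) - δ i := ⟨_, rfl⟩
  have hdc₂ : dc % 4 = 2 := by
    unfold CrossesLevel at cj
    split_ifs at hdc <;> omega
  have key : T = 4 ∨ T = -4 := by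
    obtain ⟨X, X₀, Xm, X₁, X₂⟩ : ∃ X : ℕ → ℤ, X 0 = x i ∧
        (∀ k, 1 ≤ k → k ≤ n → X k = x (i + k)) ∧ X (n + 1) = x (i + n) ∧ X (n + 2) = x i :=
      ⟨fun k => if k = n + 2 then x i else if k = n + 1 then x (i + n) else x (i + k),
        by simp, fun k _ _ => by grind, by simp, by simp⟩
    obtain ⟨Y, Y₀, Ym, Y₁, Y₂⟩ : ∃ Y : ℕ → ℤ, Y 0 = c ∧
        (∀ k, 1 ≤ k → k ≤ n → Y k = y (i + k)) ∧ Y (n + 1) = c ∧ Y (n + 2) = c :=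
      ⟨fun k => if 1 ≤ k ∧ k ≤ n then y (i + k) else c,
        by simp, fun k _ _ => by grind, by simp, by simp⟩
    obtain ⟨D, Dm, D₁, D₂⟩ : ∃ D : ℕ → ℤ, (∀ k, k ≤ n → D k = δ (i + k)) ∧
        D (n + 1) = dc ∧ D (n + 2) = δ i + T :=
      ⟨fun k => if k = n + 2 then δ i + T else if k = n + 1 then dc else δ (i + k),
        fun k _ => by grind, by simp, by simp⟩
    have D₀ : D 0 = δ i := Dm 0 (by omega)
    have edge : ∀ k ≤ n, X k = x (i + k) ∧ X (k + 1) = x (i + k + 1) ∧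
        min (y (i + k)) (y (i + k + 1)) ≤ min (Y k) (Y (k + 1)) ∧
        max (Y k) (Y (k + 1)) ≤ max (y (i + k)) (y (i + k + 1)) ∧
        AxisStep (X k) (Y k) (X (k + 1)) (Y (k + 1)) (D k) := by
      intro k hk
      have sk := P.step (i + k) (by omega) (by omega)
      rcases Nat.eq_zero_or_pos k with rfl | hk₀
      · rw [Xm (0 + 1) (by omega) (by omega), Ym (0 + 1) (by omega) (by omega), X₀, Y₀, D₀]
        unfold CrossesLevel at ci
        clear cj sj hfree Xm Ym Dm
        simp only [add_zero, zero_add] at *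
        unfold AxisStep at sk
        refine ⟨trivial, trivial, by omega, by omega, ?_⟩
        rcases ci with ⟨d, c₁, c₂⟩ | ⟨d, c₁, c₂⟩
        · exact Or.inr (Or.inl ⟨d, by omega, c₂⟩)
        · exact Or.inr (Or.inr (Or.inr ⟨d, by omega, c₁⟩))
      · rcases hk.lt_or_eq with hk | rfl
        · rw [Xm k hk₀ hk.le, Ym k hk₀ hk.le, Xm (k + 1) (by omega) hk, Ym (k + 1) (by omega) hk,
            Dm k hk.le]
          exact ⟨rfl, rfl, le_rfl, le_rfl, sk⟩
        · rw [Xm k hk₀ le_rfl, Ym k hk₀ le_rfl, X₁, Y₁, Dm k le_rfl]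
          unfold CrossesLevel at cj
          unfold AxisStep at *
          omega
    have Q : SimplePolygon X Y D (n + 2) T := by
      refine ⟨by omega, by rw [X₀, X₂], by rw [Y₀, Y₂], by rw [D₀, D₂], ?_, ?_, ?_, ?_⟩
      · unfold CrossesLevel at ci
        split_ifs at hT <;> omega
      · intro k hk
        rcases (by omega : k ≤ n ∨ k = n + 1) with hk | rfl
        · exact (edge k hk).2.2.2.2
        · rw [X₁, X₂, Y₁, Y₂, D₁]
          exact Or.inr (Or.inr (Or.inl ⟨hdc₂, hx, rfl⟩))
      · intro k hk
        rcases (by omega : k < n ∨ k = n ∨ k = n + 1) with hk | rfl | rfl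
        · rw [Dm k hk.le, Dm (k + 1) hk]
          exact P.turn (i + k) (by omega) (by omega)
        · rw [Dm k le_rfl, D₁]
          split_ifs at hdc <;> omega
        · rw [D₁, D₂]
          split_ifs at hT <;> omega
      · intro k l h₁ h₂ h₃
        obtain ⟨ek₁, ek₂, ek₃, ek₄, -⟩ := edge k (by omega)
        rcases (by omega : l ≤ n ∨ l = n + 1) with hl | rfl
        · obtain ⟨el₁, el₂, el₃, el₄, -⟩ := edge l hl
          have := P.sep (i + k) (i + l) (by omega) (by omega) (by omega)
          rw [ek₁, ek₂, el₁, el₂]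
          clear * - this ek₃ ek₄ el₃ el₄
          unfold BoxSep at *
          omega
        · have hk₀ : 1 ≤ k := by omega
          have hk : k < n := by omega
          rw [ek₁, ek₂, Ym k hk₀ hk.le, Ym (k + 1) (by omega) hk, X₁, X₂, Y₁, Y₂,
            ← Nat.add_assoc i k 1]
          clear ek₁ ek₂ ek₃ ek₄ Xm Ym Dm X₀ Y₀
          have sk := P.step (i + k) (by omega) (by omega)
          have c₀ := hc (i + k) (by omega) (by omega)
          have c₁ := hc (i + k + 1) (by omega) (by omega)
          have free := hfree (i + k) (by omega) (by omega)
          have xi : CrossesLevel y δ c (i + k) → x (i + k) ≠ x i := by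
            intro h e
            rcases (by omega : k = 1 ∨ 1 < k) with rfl | hk₁
            · have := P.turn i hi (by omega)
              unfold CrossesLevel at h ci
              omega
            · have := P.sep i (i + k) hi (by omega) (by omega)
              unfold CrossesLevel at h ci
              unfold AxisStep at si sk
              unfold BoxSep at this
              omega
          have xj : CrossesLevel y δ c (i + k) → x (i + k) ≠ x (i + n) := by
            intro h e
            rcases (by omega : k + 1 = n ∨ k + 1 < n) with rfl | hk₁
            · have := P.turn (i + k) (by omega) (by omega)
              unfold CrossesLevel at h cj
              rw [show i + (k + 1) = i + k + 1 from rfl] at cj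
              omega
            · have := P.sep (i + k) (i + n) (by omega) (by omega) (by omega)
              unfold CrossesLevel at h cj
              unfold AxisStep at sj sk
              unfold BoxSep at this
              omega
          unfold BoxSep
          rw [max_self, min_self, max_eq_left hx.le, min_eq_right hx.le]
          by_cases h : CrossesLevel y δ c (i + k)
          · have : ¬ (x i < x (i + k) ∧ x (i + k) < x (i + n)) := fun e => free h e.1 e.2
            have := xi h
            have := xj h
            unfold CrossesLevel at h
            unfold AxisStep at sk
            omega
          · unfold CrossesLevel at h
            unfold AxisStep at sk
            omega
    exact Q.turning
  split_ifs at hdc hT <;> omega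

/-- Among the edges between two crossings of a horizontal line, either none crosses the line
between them or there is a leftmost such crossing. -/
theorem exists_leftmost_crossing (x y δ : ℕ → ℤ) (c : ℤ) (i j : ℕ)
    (h : ∃ k, i < k ∧ k < j ∧ CrossesLevel y δ c k ∧ x i < x k ∧ x k < x j) :
    ∃ k, i < k ∧ k < j ∧ CrossesLevel y δ c k ∧ x i < x k ∧ x k < x j ∧
      ∀ m, i < m → m < k → CrossesLevel y δ c m → x i < x m → x m < x k → False := by
  classical
  obtain ⟨k₀, hk₀⟩ := h
  obtain ⟨k, hk, hmin⟩ := Finset.exists_min_image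
    ((Finset.range j).filter fun k => i < k ∧ k < j ∧ CrossesLevel y δ c k ∧ x i < x k ∧ x k < x j)
    x ⟨k₀, by simp [hk₀]⟩
  obtain ⟨-, h₁, h₂, h₃, h₄, h₅⟩ := Finset.mem_filter.1 hk
  refine ⟨k, h₁, h₂, h₃, h₄, h₅, fun m m₁ m₂ m₃ m₄ m₅ => ?_⟩
  have := hmin m (Finset.mem_filter.2 ⟨Finset.mem_range.2 (by omega), m₁, by omega, m₃, m₄,
    by omega⟩)
  omega

/-- The total turning between two crossings of a horizontal line is bounded by their distance. -/
theorem SimplePath.turning_le {x y δ : ℕ → ℤ} {lo top : ℕ}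
    (P : SimplePath x y δ lo top) {c : ℤ} (hc : ∀ k, lo ≤ k → k ≤ top + 1 → y k ≠ c)
    {i j : ℕ} (hi : lo ≤ i) (hij : i < j) (hj : j ≤ top)
    (ci : CrossesLevel y δ c i) (cj : CrossesLevel y δ c j) (hx : x i < x j)
    (hj₃ : δ j % 4 = 3) :
    (δ i % 4 = 1 → δ j - δ i ≤ 4 * (x j - x i) + 2) ∧
    (δ i % 4 = 3 → δ j - δ i ≤ 4 * (x j - x i)) := by
  induction hn : j - i using Nat.strong_induction_on generalizing i with
  | _ n ih =>
    by_cases h : ∃ k, i < k ∧ k < j ∧ CrossesLevel y δ c k ∧ x i < x k ∧ x k < x j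
    · obtain ⟨k, h₁, h₂, h₃, h₄, h₅, h₆⟩ := exists_leftmost_crossing x y δ c i j h
      have a₁ := P.turning_of_free_level hc hi h₁ (by omega) ci h₃ h₄ h₆
      have a₂ := ih (j - k) (by omega) (by omega) h₂ h₃ h₅ rfl
      have : δ k % 4 = 1 ∨ δ k % 4 = 3 := h₃.imp And.left And.left
      omega
    · have := P.turning_of_free_level hc hi hij hj ci cj hx
        fun k h₁ h₂ h₃ h₄ h₅ => h ⟨k, h₁, h₂, h₃, h₄, h₅⟩
      omega

/-- The horizontal distance between the two ends of a subpath which leaves a free level to the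
north and returns to it from the north. -/
theorem SimplePath.abs_turning_le {x y δ : ℕ → ℤ} {lo top : ℕ}
    (P : SimplePath x y δ lo top) {c : ℤ} (hc : ∀ k, lo ≤ k → k ≤ top + 1 → y k ≠ c)
    {i j : ℕ} (hi : lo ≤ i) (hij : i < j) (hj : j ≤ top)
    (ci : CrossesLevel y δ c i) (cj : CrossesLevel y δ c j) (hx : x i < x j)
    (hi₁ : δ i % 4 = 1) (hj₃ : δ j % 4 = 3) (hT : 0 ≤ δ j - δ i) :
    1 + |(δ j - δ i - 2) / 4 - 1| ≤ x j - x i := by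
  have h := (P.turning_le hc hi hij hj ci cj hx hj₃).1 hi₁
  rcases le_or_gt 1 ((δ j - δ i - 2) / 4) with hk | hk
  · rw [abs_of_nonneg (by omega)]
    omega
  · rw [abs_of_neg (by omega)]
    by_contra hlt
    have h₁ : x j = x i + 1 := by omega
    have := (P.turning_of_free_level hc hi hij hj ci cj hx
      fun k _ _ _ h₂ h₃ => by omega).2.1 hi₁ hj₃
    omega

/-- Peeling off steps of a northeast staircase at the start and of a southeast staircase at the
end strengthens `SimplePath.abs_turning_le`. -/
theorem SimplePath.min_add_abs_turning_le {x y δ : ℕ → ℤ} {lo top : ℕ}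
    (P : SimplePath x y δ lo top) (hy : ∀ k, lo ≤ k → k ≤ top + 1 → (4 : ℤ) ∣ y k)
    (A B : ℕ) (hA : 1 ≤ A) (hB : 1 ≤ B) {Y : ℤ} (hY : 4 ∣ Y)
    {i j : ℕ} (hi : lo ≤ i) (hij : i < j) (hj : j ≤ top)
    (hi₁ : δ i % 4 = 1) (hj₃ : δ j % 4 = 3) (yi : y i ≤ Y) (yi' : Y < y (i + 1))
    (yj : Y < y j) (yj' : y (j + 1) ≤ Y) (hx : x i < x j) (hT : 0 ≤ δ j - δ i)
    (sO : ∀ m, i ≤ m → m + 2 ≤ i + 2 * A → δ m % 4 = 0 ∨ δ m % 4 = 1)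
    (sP : ∀ m, m ≤ j → j + 2 ≤ m + 2 * B → δ m % 4 = 0 ∨ δ m % 4 = 3) :
    (min A B : ℕ) + |(δ j - δ i - 2) / 4 - 1| ≤ x j - x i := by
  induction hn : A + B using Nat.strong_induction_on generalizing A B Y i j with
  | _ n ih =>
    by_cases h1 : A = 1 ∨ B = 1
    · have : min A B = 1 := by omega
      rw [this]
      have d₁ := hy i hi (by omega)
      have d₂ := hy (i + 1) (by omega) (by omega)
      have d₃ := hy j (by omega) (by omega)
      have d₄ := hy (j + 1) (by omega) (by omega)
      refine P.abs_turning_le (c := Y + 1) (fun k h₁ h₂ => ?_) hi hij hj (Or.inl ⟨hi₁, ?_, ?_⟩)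
        (Or.inr ⟨hj₃, ?_, ?_⟩) hx hi₁ hj₃ hT
      · have := hy k h₁ h₂
        omega
      all_goals omega
    have hA₂ : 2 ≤ A := by omega
    have hB₂ : 2 ≤ B := by omega
    have o₁ := sO (i + 1) (by omega) (by omega)
    have o₂ := sO (i + 2) (by omega) (by omega)
    have hij₁ : i + 2 ≤ j := by
      by_contra h
      obtain rfl : j = i + 1 := by omega
      omega
    have hij₂ : i + 2 ≠ j := by
      rintro rfl
      omega
    obtain ⟨q, rfl⟩ : ∃ q, j = q + 2 := ⟨j - 2, by omega⟩
    have p₁ := sP (q + 1) (by omega) (by omega)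
    have p₂ := sP q (by omega) (by omega)
    have ti := P.turn i hi (by omega)
    have ti' := P.turn (i + 1) (by omega) (by omega)
    have tj := P.turn q (by omega) (by omega)
    have tj' := P.turn (q + 1) (by omega) (by omega)
    simp only [Nat.add_assoc, Nat.reduceAdd] at ti' tj' yj'
    have ei : δ (i + 2) = δ i := by omega
    have ei' : δ (i + 1) = δ i - 1 := by omega
    have ej : δ q = δ (q + 2) := by omega
    have ej' : δ (q + 1) = δ (q + 2) + 1 := by omega
    have hne₁ : q ≠ i := by
      rintro rfl
      omega
    have hne₂ : q ≠ i + 1 := by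
      rintro rfl
      omega
    have hne₃ : q ≠ i + 2 := by
      rintro rfl
      omega
    have s₀ := P.step i hi (by omega)
    have s₁ := P.step (i + 1) (by omega) (by omega)
    have s₂ := P.step (i + 2) (by omega) (by omega)
    have r₀ := P.step q (by omega) (by omega)
    have r₁ := P.step (q + 1) (by omega) (by omega)
    have r₂ := P.step (q + 2) (by omega) (by omega)
    simp only [Nat.add_assoc, Nat.reduceAdd] at s₁ s₂ r₁ r₂
    have s₀' : x (i + 1) = x i ∧ y i < y (i + 1) := by
      clear * - s₀ hi₁
      unfold AxisStep at s₀
      omega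
    have s₁' : x (i + 1) < x (i + 2) ∧ y (i + 2) = y (i + 1) := by
      clear * - s₁ hi₁ ei'
      unfold AxisStep at s₁
      omega
    have s₂' : x (i + 3) = x (i + 2) ∧ y (i + 2) < y (i + 3) := by
      clear * - s₂ hi₁ ei
      unfold AxisStep at s₂
      omega
    have r₀' : x (q + 1) = x q ∧ y (q + 1) < y q := by
      clear * - r₀ hj₃ ej
      unfold AxisStep at r₀
      omega
    have r₁' : x (q + 1) < x (q + 2) ∧ y (q + 2) = y (q + 1) := by
      clear * - r₁ hj₃ ej'
      unfold AxisStep at r₁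
      omega
    have r₂' : x (q + 3) = x (q + 2) ∧ y (q + 3) < y (q + 2) := by
      clear * - r₂ hj₃
      unfold AxisStep at r₂
      omega
    clear s₀ s₁ s₂ r₀ r₁ r₂
    have sO' : ∀ m, i + 2 ≤ m → m + 2 ≤ i + 2 + 2 * (A - 1) → δ m % 4 = 0 ∨ δ m % 4 = 1 :=
      fun m h₁ h₂ => sO m (by omega) (by omega)
    have sP' : ∀ m, m ≤ q → q + 2 ≤ m + 2 * (B - 1) → δ m % 4 = 0 ∨ δ m % 4 = 3 :=
      fun m h₁ h₂ => sP m (by omega) (by omega)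
    rcases lt_trichotomy (y (i + 1)) (y (q + 2)) with h | h | h
    · have hs := P.sep (i + 1) (q + 2) (by omega) (by omega) hj
      simp only [Nat.add_assoc, Nat.reduceAdd] at hs
      have hs' : x (i + 2) < x (q + 2) := by
        clear * - hs s₀' s₁' r₂' h yi' yj' hx
        unfold BoxSep at hs
        omega
      have := ih (A - 1 + B) (by omega) (A - 1) B (by omega) hB (hy (i + 1) (by omega) (by omega))
        (i := i + 2) (j := q + 2) (by omega) (by omega) hj (by rw [ei]; exact hi₁) hj₃ s₁'.2.le
        (by simp only [Nat.add_assoc, Nat.reduceAdd]; omega) h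
        (by simp only [Nat.add_assoc, Nat.reduceAdd]; omega) hs' (by omega) sO' sP rfl
      rw [ei] at this
      omega
    · have hs := P.sep (i + 1) (q + 1) (by omega) (by omega) (by omega)
      simp only [Nat.add_assoc, Nat.reduceAdd] at hs
      have hs' : x (i + 2) < x (q + 1) := by
        clear * - hs s₀' s₁' r₁' h hx
        unfold BoxSep at hs
        omega
      have := ih (A - 1 + (B - 1)) (by omega) (A - 1) (B - 1) (by omega) (by omega)
        (hy (i + 1) (by omega) (by omega))
        (i := i + 2) (j := q) (by omega) (by omega) (by omega) (by rw [ei]; exact hi₁)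
        (by rw [ej]; exact hj₃) s₁'.2.le
        (by simp only [Nat.add_assoc, Nat.reduceAdd]; omega) (by omega)
        (by omega) (by omega) (by omega) sO' sP' rfl
      rw [ei, ej] at this
      omega
    · have hs := P.sep i (q + 1) hi (by omega) (by omega)
      simp only [Nat.add_assoc, Nat.reduceAdd] at hs
      have hs' : x i < x q := by
        clear * - hs s₀' r₀' r₁' h yi yj hx
        unfold BoxSep at hs
        omega
      have := ih (A + (B - 1)) (by omega) A (B - 1) hA (by omega)
        (hy (q + 2) (by omega) (by omega))
        (i := i) (j := q) hi (by omega) (by omega) hi₁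
        (by rw [ej]; exact hj₃) (by omega) h (by omega)
        (by omega) hs' (by omega) sO sP' rfl
      rw [ej] at this
      omega

theorem axisStep_iff_unitDir (u v : ℤ × ℤ) (d : ℤ) : AxisStep u.1 u.2 v.1 v.2 d ↔
    (d % 4 = 0 ∧ unitDir u v = (1, 0)) ∨ (d % 4 = 1 ∧ unitDir u v = (0, 1)) ∨
    (d % 4 = 2 ∧ unitDir u v = (-1, 0)) ∨ (d % 4 = 3 ∧ unitDir u v = (0, -1)) := by
  simp only [AxisStep, unitDir, Prod.mk.injEq, Int.sign_eq_one_iff_pos, Int.sign_eq_neg_one_iff_neg,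
    Int.sign_eq_zero_iff_zero, sub_pos, sub_neg, sub_eq_zero]

theorem boxSep_of_segSet_inter_eq_empty {u v w z : ℤ × ℤ} (h : segSet u v ∩ segSet w z = ∅) :
    BoxSep u.1 u.2 v.1 v.2 w.1 w.2 z.1 z.2 := by
  have hq := Set.eq_empty_iff_forall_notMem.1 h
    (max (min u.1 v.1) (min w.1 z.1), max (min u.2 v.2) (min w.2 z.2))
  simp only [segSet, Set.mem_inter_iff, Set.mem_ofPred_eq] at hq
  unfold BoxSep
  by_contra hn
  push Not at hn
  obtain ⟨h₁, h₂, h₃, h₄⟩ := hn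
  apply hq
  refine ⟨⟨?_, ?_, ?_, ?_⟩, ?_, ?_, ?_, ?_⟩ <;> clear * - h₁ h₂ h₃ h₄ <;> omega

theorem delta_succ (σ : List Turn) {i : ℕ} (h : i < σ.length) :
    delta σ (i + 1) = delta σ i + if σ.get ⟨i, h⟩ = Turn.L then 1 else -1 := by
  unfold delta
  rw [List.take_add_one, List.getElem?_eq_getElem h]
  simp only [List.get_eq_getElem, List.count_append, Option.toList_some]
  obtain h' | h' : σ[i] = Turn.L ∨ σ[i] = Turn.R := by cases σ[i] <;> simp
  all_goals
    simp [h']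
    ring

theorem delta_length (σ : List Turn) : delta σ σ.length = excess σ := by
  simp [delta, excess]

theorem Chain.axisStep {σ : List Turn} (C : Chain σ) (k : ℕ) (hk : k ≤ σ.length) :
    AxisStep (C.pts k).1 (C.pts k).2 (C.pts (k + 1)).1 (C.pts (k + 1)).2 (delta σ k) := by
  induction k with
  | zero =>
    obtain ⟨t, ht, h⟩ := C.first_seg
    simp [AxisStep, C.start_eq, h, delta, ht]
  | succ k ih =>
    have h := C.turns k hk
    have hd := delta_succ σ hk
    have ih := (axisStep_iff_unitDir _ _ _).1 (ih (by omega))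
    rw [axisStep_iff_unitDir, h]
    split_ifs at hd ⊢ <;> rcases ih with ⟨h₁, h₂⟩ | ⟨h₁, h₂⟩ | ⟨h₁, h₂⟩ | ⟨h₁, h₂⟩ <;>
      rw [h₂] <;> simp [rotCCW, rotCW] <;> omega

/-- The vertices of a chain, with vertical coordinates scaled by four to make room for levels
avoiding all vertices. -/
theorem Chain.simplePath {σ : List Turn} (C : Chain σ) :
    SimplePath (fun k => (C.pts k).1) (fun k => 4 * (C.pts k).2) (delta σ) 0 σ.length where
  step k _ hk := by
    have := C.axisStep k hk
    unfold AxisStep at *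
    omega
  turn k _ hk := by
    have := delta_succ σ hk
    split_ifs at this <;> omega
  sep k l _ hkl hl := by
    have := boxSep_of_segSet_inter_eq_empty (C.simple_nonadj k l hkl hl)
    unfold BoxSep at *
    omega

theorem SimplePath.parity {x y δ : ℕ → ℤ} {hi : ℕ} (P : SimplePath x y δ 0 hi) (h₀ : δ 0 = 0)
    (k : ℕ) (hk : k ≤ hi) : δ k % 2 = (k : ℤ) % 2 := by
  induction k with
  | zero => simp [h₀]
  | succ k ih =>
    have := P.turn k (by omega) (by omega)
    have := ih (by omega)
    push_cast
    omega

theorem Chain.delta_mod_of_dirOf {σ : List Turn} (C : Chain σ) {k : ℕ} (hk : k ≤ σ.length) :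
    (dirOf σ C k = (1, 0) → delta σ k % 4 = 0) ∧ (dirOf σ C k = (0, 1) → delta σ k % 4 = 1) ∧
    (dirOf σ C k = (0, -1) → delta σ k % 4 = 3) := by
  have := (axisStep_iff_unitDir _ _ _).1 (C.axisStep k hk)
  unfold dirOf
  refine ⟨fun h => ?_, fun h => ?_, fun h => ?_⟩ <;> rw [h] at this <;> simpa using this

theorem Chain.exists_stairCountO_le {σ : List Turn} (C : Chain σ) (hn : 1 ≤ σ.length)
    (h₁ : delta σ 1 = 1) : ∃ A : ℕ, 1 ≤ A ∧ stairCountO σ C (1, 0) (0, 1) ≤ A ∧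
      ∀ m, m + 2 ≤ 1 + 2 * A → delta σ m % 4 = 0 ∨ delta σ m % 4 = 1 := by
  classical
  have h₀ : delta σ 0 = 0 := by simp [delta]
  let Q : ℕ → Prop := fun m => ∀ j ≤ m, delta σ j % 4 = 0 ∨ delta σ j % 4 = 1
  have hQ : Q 1 := fun j hj => by
    obtain rfl | rfl : j = 0 ∨ j = 1 := by omega
    all_goals omega
  have hM : Q (Nat.findGreatest Q σ.length) := Nat.findGreatest_spec hn hQ
  have hM₁ : 1 ≤ Nat.findGreatest Q σ.length := Nat.le_findGreatest hn hQ
  refine ⟨(Nat.findGreatest Q σ.length + 1) / 2, by omega, ?_, fun m hm => hM m (by omega)⟩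
  have key : ∀ i, (i ≤ σ.length ∧ dirOf σ C i = (0, 1) ∧
      ∀ j ≤ i, dirOf σ C j = (1, 0) ∨ dirOf σ C j = (0, 1)) →
      i % 2 = 1 ∧ i / 2 < (Nat.findGreatest Q σ.length + 1) / 2 := by
    rintro i ⟨hi, hd, hs⟩
    have h := C.simplePath.parity h₀ i hi
    have := (C.delta_mod_of_dirOf hi).2.1 hd
    have : i ≤ Nat.findGreatest Q σ.length := Nat.le_findGreatest hi fun j hj =>
      (hs j hj).imp (C.delta_mod_of_dirOf (by omega)).1 (C.delta_mod_of_dirOf (by omega)).2.1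
    omega
  unfold stairCountO
  refine (Nat.card_le_card_of_injective (fun i => (⟨i.1 / 2, (key i.1 i.2).2⟩ : Fin _))
    fun i j hij => Subtype.ext ?_).trans_eq (Nat.card_fin _)
  have hi := key i.1 i.2
  have hj := key j.1 j.2
  simp only [Fin.mk.injEq] at hij
  omega

theorem Chain.exists_stairCountP_le {σ : List Turn} (C : Chain σ)
    (hn : delta σ σ.length % 4 = 3) :
    ∃ B : ℕ, 1 ≤ B ∧ stairCountP σ C (1, 0) (0, -1) ≤ B ∧
      ∀ m, m ≤ σ.length → σ.length + 2 ≤ m + 2 * B →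
        delta σ m % 4 = 0 ∨ delta σ m % 4 = 3 := by
  classical
  have h₀ : delta σ 0 = 0 := by simp [delta]
  let Q : ℕ → Prop := fun m => ∀ j, σ.length ≤ m + j → j ≤ σ.length →
    delta σ j % 4 = 0 ∨ delta σ j % 4 = 3
  have hQ : Q 0 := fun j hj hj' => by
    obtain rfl : j = σ.length := by omega
    exact Or.inr hn
  have hM : Q (Nat.findGreatest Q σ.length) := Nat.findGreatest_spec (Nat.zero_le _) hQ
  refine ⟨Nat.findGreatest Q σ.length / 2 + 1, by omega, ?_,
    fun m hm hm' => hM m (by omega) hm⟩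
  have key : ∀ i, (i ≤ σ.length ∧ dirOf σ C i = (0, -1) ∧
      ∀ j, i ≤ j → j ≤ σ.length → dirOf σ C j = (1, 0) ∨ dirOf σ C j = (0, -1)) →
      i ≤ σ.length ∧ i % 2 = 1 ∧
        (σ.length - i) / 2 < Nat.findGreatest Q σ.length / 2 + 1 := by
    rintro i ⟨hi, hd, hs⟩
    have h := C.simplePath.parity h₀ i hi
    have := (C.delta_mod_of_dirOf hi).2.2 hd
    have : σ.length - i ≤ Nat.findGreatest Q σ.length :=
      Nat.le_findGreatest (by omega) fun j hj hj' => (hs j (by omega) hj').imp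
        (C.delta_mod_of_dirOf (by omega)).1 (C.delta_mod_of_dirOf (by omega)).2.2
    omega
  unfold stairCountP
  refine (Nat.card_le_card_of_injective
    (fun i => (⟨(σ.length - i.1) / 2, (key i.1 i.2).2.2⟩ : Fin _))
    fun i j hij => Subtype.ext ?_).trans_eq (Nat.card_fin _)
  have hi := key i.1 i.2
  have hj := key j.1 j.2
  simp only [Fin.mk.injEq] at hij
  omega

/-- Moving the start of a path whose first edge points south a bit to the north. -/
theorem SimplePath.raise_start {x z δ : ℕ → ℤ} {hi : ℕ}
    (P : SimplePath x (fun k => 4 * z k) δ 0 hi) (hδ : δ 1 % 4 = 3) :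
    SimplePath x (fun k => if k = 1 then 4 * z 1 + 2 else 4 * z k) δ 1 hi where
  step k hk hk' := by
    have := P.step k (by omega) hk'
    unfold AxisStep at *
    rw [if_neg (show k + 1 ≠ 1 by omega)]
    split_ifs with h
    · subst h
      omega
    · exact this
  turn k hk := P.turn k (by omega)
  sep k l hk hkl hl := by
    have := P.sep k l (by omega) hkl hl
    rw [if_neg (show k + 1 ≠ 1 by omega), if_neg (show l ≠ 1 by omega),
      if_neg (show l + 1 ≠ 1 by omega)]
    split_ifs with h
    · subst h
      clear * - this
      unfold BoxSep at *
      omega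
    · exact this

/-- **Lower bound on the closest reachable point on the `+x`-axis when
`l - r ≡ 3 (mod 4)`.** Here `stairCountO σ C (1,0) (0,1)` is `₊ₓm₊ᵧᵒ(C)` and
`stairCountP σ C (1,0) (0,-1)` is `₊ₓm₋ᵧᵖ(C)`. -/
theorem lower_bound_x_plus_mod_three (σ : List Turn) (h0 : 0 ≤ excess σ)
    (h3 : excess σ % 4 = 3) (C : Chain σ) (a : ℤ) (ha : 0 < a)
    (hend : C.pts (σ.length + 1) = (a, 0)) :
    (σ.head? = some Turn.L →
      ((min (stairCountO σ C (1, 0) (0, 1)) (stairCountP σ C (1, 0) (0, -1)) : ℕ) : ℤ) +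
        |(excess σ + 2) / 4 - 2| + 1 ≤ a) ∧
    (σ.head? = some Turn.R → (excess σ + 2) / 4 + 1 ≤ a) := by
  obtain ⟨t, ht, hp₁⟩ := C.first_seg
  have h₀ : delta σ 0 = 0 := by simp [delta]
  have hn₃ : delta σ σ.length % 4 = 3 := by rw [delta_length, h3]
  have hn : 1 ≤ σ.length := by
    by_contra h
    rw [show σ.length = 0 by omega, h₀] at hn₃
    omega
  have hpn := C.axisStep σ.length le_rfl
  rw [hend] at hpn
  have hpn' : (C.pts σ.length).1 = a ∧ 0 < (C.pts σ.length).2 := by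
    clear * - hpn hn₃
    unfold AxisStep at hpn
    omega
  have hδ₁ := delta_succ σ hn
  rw [h₀, zero_add, zero_add, List.get_eq_getElem] at hδ₁
  have hlen := delta_length σ
  have hn₂ : 1 < σ.length := by
    by_contra h
    have h1 : σ.length = 1 := by omega
    rw [h1] at hlen
    split_ifs at hδ₁ <;> omega
  have hta : t < a := by
    have hs := boxSep_of_segSet_inter_eq_empty (C.simple_nonadj 0 σ.length hn₂ le_rfl)
    simp only [zero_add, C.start_eq, hp₁, hend] at hs
    clear * - hs hpn' ha ht
    unfold BoxSep at hs
    omega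
  have hp₂ := C.axisStep 1 hn
  simp only [Nat.reduceAdd, hp₁] at hp₂
  have hhead : σ.head? = some σ[0] := by
    rw [List.head?_eq_getElem?, List.getElem?_eq_getElem hn]
  constructor
  · intro hL
    rw [hhead, Option.some.injEq] at hL
    rw [if_pos hL] at hδ₁
    have hp₂' : (C.pts 2).1 = t ∧ 0 < (C.pts 2).2 := by
      clear * - hp₂ hδ₁
      unfold AxisStep at hp₂
      omega
    obtain ⟨A, hA, hA', sO⟩ := C.exists_stairCountO_le hn hδ₁
    obtain ⟨B, hB, hB', sP⟩ := C.exists_stairCountP_le hn₃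
    have := C.simplePath.min_add_abs_turning_le (fun k _ _ => dvd_mul_right _ _) A B hA hB
      (Y := 0) (dvd_zero _) (i := 1) (Nat.zero_le _) hn₂ le_rfl (by omega) hn₃
      (by simp [hp₁]) (by simp [hp₂'.2]) (by simp [hpn'.2]) (by simp [hend])
      (by simp only [hp₁, hpn'.1]; exact hta) (by omega) (fun m _ => sO m) sP
    simp only [hp₁, hpn'.1, hlen, hδ₁] at this
    have e : (excess σ - 1 - 2) / 4 - 1 = (excess σ + 2) / 4 - 2 := by omega
    rw [e] at this
    omega
  · intro hR
    rw [hhead, Option.some.injEq] at hR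
    rw [if_neg (by simp [hR])] at hδ₁
    have hp₂' : (C.pts 2).1 = t ∧ (C.pts 2).2 < 0 := by
      clear * - hp₂ hδ₁
      unfold AxisStep at hp₂
      omega
    have P := C.simplePath.raise_start (by omega)
    have := (P.turning_le (c := 1) (i := 1) ?_ le_rfl hn₂ le_rfl ?_ ?_ ?_ hn₃).2 (by omega)
    · simp only [hp₁, hpn'.1, hlen, hδ₁] at this
      omega
    · intro k _ _
      split_ifs <;> omega
    · refine Or.inr ⟨by omega, ?_, ?_⟩ <;> simp [hp₁]
      omega
    · refine Or.inr ⟨hn₃, ?_, ?_⟩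
      · simp only [if_neg (show σ.length + 1 ≠ 1 by omega), hend]
        omega
      · simp only [if_neg (show σ.length ≠ 1 by omega)]
        omega
    · simp only [hp₁, hpn'.1]
      exact hta
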